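/- arXiv:2310.16906 — 4 statements merged into one kernel-verified Lean document; each statement's English description precedes it below -/
import Mathlib

section
/- Let Θ ⊆ ℝ be open, let A : Θ → (symmetric positive semidefinite n×n real matrices) be differentiable, let B be a fixed symmetric positive definite n×n matrix, and for i = 1, …, r let γᵢ : Θ → ℝ and ψᵢ : Θ → ℝⁿ be differentiable with A(θ) ψᵢ(θ) = γᵢ(θ) B ψᵢ(θ), ⟨ψᵢ(θ), B ψᵢ(θ)⟩ = 1, and γᵢ(θ) ≥ 0 for all θ. Define the spectral part of the information gain Φ(θ) := ½ Σ_{i=1}^{r} [ log(1 + γᵢ(θ)) − γᵢ(θ)/(1 + γᵢ(θ)) ]. Then Φ is differentiable and Φ′(θ) = Σ_{i=1}^{r} ( γᵢ(θ) / (2 (1 + γᵢ(θ))²) ) ⟨ψᵢ(θ), A′(θ) ψᵢ(θ)⟩. -/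
open Matrix

theorem hasDerivAt_dotProduct_mulVec_self {ι : Type*} [Fintype ι] {M : ℝ → Matrix ι ι ℝ}
    {M' : Matrix ι ι ℝ} {v : ℝ → ι → ℝ} {v' : ι → ℝ} {θ : ℝ}
    (hM : ∀ i j, HasDerivAt (fun t => M t i j) (M' i j) θ)
    (hv : ∀ k, HasDerivAt (fun t => v t k) (v' k) θ) (hsymm : (M θ).IsSymm) :
    HasDerivAt (fun t => v t ⬝ᵥ (M t *ᵥ v t))
      (v θ ⬝ᵥ (M' *ᵥ v θ) + 2 * (v' ⬝ᵥ (M θ *ᵥ v θ))) θ := by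
  have h : HasDerivAt (fun t => v t ⬝ᵥ (M t *ᵥ v t))
      (v' ⬝ᵥ (M θ *ᵥ v θ) + (v θ ⬝ᵥ (M' *ᵥ v θ) + v θ ⬝ᵥ (M θ *ᵥ v'))) θ := by
    simp only [dotProduct, mulVec]
    refine (HasDerivAt.fun_sum fun i _ => (hv i).mul
      (HasDerivAt.fun_sum fun j _ => (hM i j).mul (hv j))).congr_deriv ?_
    simp only [Pi.mul_apply, Finset.sum_add_distrib, mul_add]
  refine h.congr_deriv ?_
  have hcomm : v θ ⬝ᵥ (M θ *ᵥ v') = v' ⬝ᵥ (M θ *ᵥ v θ) := by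
    rw [dotProduct_mulVec, ← mulVec_transpose, hsymm.eq, dotProduct_comm]
  rw [hcomm]
  ring

/-- First-order perturbation of a normalized generalized eigenvalue `A v = γ B v`. -/
theorem deriv_generalized_eigenvalue {ι : Type*} [Fintype ι] {A : ℝ → Matrix ι ι ℝ}
    {A' B : Matrix ι ι ℝ} {γ : ℝ → ℝ} {γ' : ℝ} {v : ℝ → ι → ℝ} {v' : ι → ℝ} {θ : ℝ}
    (hA : ∀ i j, HasDerivAt (fun t => A t i j) (A' i j) θ)
    (hγ : HasDerivAt γ γ' θ) (hv : ∀ k, HasDerivAt (fun t => v t k) (v' k) θ)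
    (hAsymm : (A θ).IsSymm) (hBsymm : B.IsSymm)
    (heig : ∀ᶠ t in nhds θ, A t *ᵥ v t = γ t • (B *ᵥ v t))
    (hnorm : ∀ᶠ t in nhds θ, v t ⬝ᵥ (B *ᵥ v t) = 1) :
    γ' = v θ ⬝ᵥ (A' *ᵥ v θ) := by
  have hAv := hasDerivAt_dotProduct_mulVec_self hA hv hAsymm
  have hBv := hasDerivAt_dotProduct_mulVec_self (M := fun _ => B) (M' := 0)
    (fun i j => hasDerivAt_const θ (B i j)) hv hBsymm
  have hγeq : γ =ᶠ[nhds θ] fun t => v t ⬝ᵥ (A t *ᵥ v t) := by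
    filter_upwards [heig, hnorm] with t h₁ h₂
    rw [h₁, dotProduct_smul, h₂, smul_eq_mul, mul_one]
  have hγ' := hγ.unique (hAv.congr_of_eventuallyEq hγeq)
  have horth := ((hasDerivAt_const θ (1 : ℝ)).congr_of_eventuallyEq hnorm).unique hBv
  simp only [zero_mulVec, dotProduct_zero, zero_add] at horth
  rw [heig.self_of_nhds, dotProduct_smul, smul_eq_mul] at hγ'
  linear_combination hγ' - γ θ * horth

theorem hasDerivAt_log_one_add_sub_div {g : ℝ → ℝ} {g' θ : ℝ} (hg : HasDerivAt g g' θ)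
    (h : 1 + g θ ≠ 0) :
    HasDerivAt (fun t => Real.log (1 + g t) - g t / (1 + g t))
      (g θ / (1 + g θ) ^ 2 * g') θ := by
  have h₁ := hg.const_add 1
  refine ((h₁.log h).sub (hg.div h₁ h)).congr_deriv ?_
  field_simp
  ring

/-- Derivative of the spectral part of the information gain
`Φ(θ) = ½ Σᵢ [log(1 + γᵢ(θ)) − γᵢ(θ)/(1 + γᵢ(θ))]`:
`Φ′(θ) = Σᵢ (γᵢ(θ) / (2(1 + γᵢ(θ))²)) ⟨ψᵢ(θ), A′(θ) ψᵢ(θ)⟩`. -/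
theorem stmt_10 {n r : ℕ} (Θ : Set ℝ) (hΘ : IsOpen Θ)
    (A A' : ℝ → Matrix (Fin n) (Fin n) ℝ)
    (hApsd : ∀ θ ∈ Θ, (A θ).PosSemidef)
    (hA : ∀ θ ∈ Θ, ∀ i j, HasDerivAt (fun t => A t i j) (A' θ i j) θ)
    (B : Matrix (Fin n) (Fin n) ℝ) (hB : B.PosDef)
    (γ γ' : Fin r → ℝ → ℝ) (ψ ψ' : Fin r → ℝ → Fin n → ℝ)
    (hγ : ∀ i, ∀ θ ∈ Θ, HasDerivAt (γ i) (γ' i θ) θ)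
    (hψ : ∀ i, ∀ θ ∈ Θ, ∀ k, HasDerivAt (fun t => ψ i t k) (ψ' i θ k) θ)
    (heig : ∀ i, ∀ θ ∈ Θ, A θ *ᵥ ψ i θ = γ i θ • (B *ᵥ ψ i θ))
    (hnorm : ∀ i, ∀ θ ∈ Θ, ψ i θ ⬝ᵥ (B *ᵥ ψ i θ) = 1)
    (hγnonneg : ∀ i, ∀ θ ∈ Θ, 0 ≤ γ i θ)
    (Φ : ℝ → ℝ)
    (hΦ : ∀ t, Φ t = (1 / 2) * ∑ i, (Real.log (1 + γ i t) - γ i t / (1 + γ i t))) :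
    ∀ θ ∈ Θ, HasDerivAt Φ
      (∑ i, (γ i θ / (2 * (1 + γ i θ) ^ 2)) * (ψ i θ ⬝ᵥ (A' θ *ᵥ ψ i θ))) θ := by
  intro θ hθ
  have hmem : ∀ᶠ t in nhds θ, t ∈ Θ := hΘ.mem_nhds hθ
  have hBsymm : B.IsSymm := by simpa using hB.isHermitian
  have hAsymm : (A θ).IsSymm := by simpa using (hApsd θ hθ).isHermitian
  rw [funext hΦ]
  refine ((HasDerivAt.fun_sum fun i _ => hasDerivAt_log_one_add_sub_div (hγ i θ hθ)
    (by linarith [hγnonneg i θ hθ] : 0 < 1 + γ i θ).ne').const_mul (1 / 2)).congr_deriv ?_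
  rw [Finset.mul_sum]
  refine Finset.sum_congr rfl fun i _ => ?_
  rw [deriv_generalized_eigenvalue (hA θ hθ) (hγ i θ hθ) (hψ i θ hθ) hAsymm hBsymm
    (hmem.mono (heig i)) (hmem.mono (hnorm i))]
  rw [← div_div]
  ring
end

section
/- In the abstract linear PDE-constrained setting, J is twice Fréchet differentiable, its second derivative is independent of m, and for all directions m̂, m̃ ∈ M it is given by the adjoint-based expression J″(m)(m̂, m̃) = ⟨R m̂, m̃⟩ + c(p̂, m̃), where û ∈ U is the unique solution of the incremental state equation a(p̃, û) + c(p̃, m̂) = 0 for all p̃ ∈ U, and p̂ ∈ U is the unique solution of the incremental adjoint equation ⟨Γ⁻¹ Q û, Q ũ⟩ + a(p̂, ũ) = 0 for all ũ ∈ U. -/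
open Matrix
open scoped RealInnerProductSpace

/-- Derivative of `x ↦ ½ B(Tx + r, Tx + r)` for a symmetric continuous bilinear form `B`. -/
theorem hasFDerivAt_half_quadratic_comp_affine {E F : Type*}
    [NormedAddCommGroup E] [NormedSpace ℝ E] [NormedAddCommGroup F] [NormedSpace ℝ F]
    (B : F →L[ℝ] F →L[ℝ] ℝ) (hB : ∀ x y, B x y = B y x) (T : E →L[ℝ] F) (r : F) (x : E) :
    HasFDerivAt (fun x => (1 / 2 : ℝ) * B (T x + r) (T x + r)) ((B (T x + r)).comp T) x := by
  have hT : HasFDerivAt (fun x => T x + r) T x := T.hasFDerivAt.add_const r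
  refine (((B.hasFDerivAt_of_bilinear hT hT).const_mul (1 / 2))).congr_fderiv ?_
  ext y
  simp [hB (T y)]
  ring

/-- The derivative `x ↦ B(Tx + r, T ·)` of a quadratic functional is affine. -/
theorem hasFDerivAt_bilinear_comp_affine {E F : Type*}
    [NormedAddCommGroup E] [NormedSpace ℝ E] [NormedAddCommGroup F] [NormedSpace ℝ F]
    (B : F →L[ℝ] F →L[ℝ] ℝ) (T : E →L[ℝ] F) (r : F) (x : E) :
    HasFDerivAt (fun x => (B (T x + r)).comp T) (B.bilinearComp T T) x := by
  have h := ((B.bilinearComp T T).hasFDerivAt (x := x)).add_const ((B r).comp T)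
  refine h.congr_of_eventuallyEq (Filter.Eventually.of_forall fun z => ?_)
  ext y
  simp

/-- The solution of the affine state equation `a(·, u m) + c(·, m) + d = 0` is an affine function
of `m`, whose linear part is continuous and solves the homogeneous equation. -/
theorem exists_continuousLinearMap_state {U M : Type*}
    [NormedAddCommGroup U] [NormedSpace ℝ U] [CompleteSpace U]
    [NormedAddCommGroup M] [NormedSpace ℝ M]
    (a : U →L[ℝ] U →L[ℝ] ℝ) (c : U →L[ℝ] M →L[ℝ] ℝ) (d : U →L[ℝ] ℝ)
    (ha : ∀ ℓ : U →L[ℝ] ℝ, ∃! w : U, ∀ pt : U, a pt w = ℓ pt)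
    (u : M → U) (hu : ∀ m : M, ∀ pt : U, a pt (u m) + c pt m + d pt = 0) :
    ∃ S : M →L[ℝ] U, (∀ m pt, a pt (S m) + c pt m = 0) ∧ ∀ m, u m = S m + u 0 := by
  have hbij : Function.Bijective a.flip := by
    refine (Function.bijective_iff_existsUnique _).2 fun ℓ => ?_
    simpa [ContinuousLinearMap.ext_iff] using ha ℓ
  let e := ContinuousLinearEquiv.ofBijective a.flip
    (LinearMap.ker_eq_bot.2 hbij.1) (LinearMap.range_eq_top.2 hbij.2)
  have he : ∀ ℓ pt, a pt (e.symm ℓ) = ℓ pt := fun ℓ pt =>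
    DFunLike.congr_fun (e.apply_symm_apply ℓ) pt
  refine ⟨-((e.symm : (U →L[ℝ] ℝ) →L[ℝ] U).comp c.flip), fun m pt => ?_, fun m => ?_⟩
  · simp [he]
  · refine hbij.1 (ContinuousLinearMap.ext fun pt => ?_)
    have h₁ := hu m pt
    have h₂ := hu 0 pt
    simp only [map_zero] at h₂
    simp [he]
    linarith

/-- The bilinear form `(x, y) ↦ A x ⬝ y` of a matrix, as a continuous bilinear map. -/
theorem exists_continuousLinearMap_mulVec_dotProduct {q : ℕ} (A : Matrix (Fin q) (Fin q) ℝ) :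
    ∃ G : (Fin q → ℝ) →L[ℝ] (Fin q → ℝ) →L[ℝ] ℝ, ∀ x y, G x y = (A *ᵥ x) ⬝ᵥ y :=
  ⟨LinearMap.toContinuousBilinearMap ((dotProductBilin ℝ ℝ).comp A.mulVecLin), fun _ _ => rfl⟩

/-- The objective `J` is twice Fréchet differentiable, with second derivative
independent of `m` and given by the adjoint-based expression
`J″(m)(m̂, m̃) = ⟨R m̂, m̃⟩ + c(p̂, m̃)` via the incremental state/adjoint equations. -/
theorem stmt_12 {U M : Type*}
    [NormedAddCommGroup U] [InnerProductSpace ℝ U] [CompleteSpace U]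
    [NormedAddCommGroup M] [InnerProductSpace ℝ M] [CompleteSpace M]
    {q : ℕ}
    (a : U →L[ℝ] U →L[ℝ] ℝ) (c : U →L[ℝ] M →L[ℝ] ℝ) (d : U →L[ℝ] ℝ)
    (ha₁ : ∀ ℓ : U →L[ℝ] ℝ, ∃! w : U, ∀ pt : U, a pt w = ℓ pt)
    (ha₂ : ∀ ℓ : U →L[ℝ] ℝ, ∃! v : U, ∀ ut : U, a v ut = ℓ ut)
    (Q : U →L[ℝ] (Fin q → ℝ)) (Γ : Matrix (Fin q) (Fin q) ℝ) (hΓ : Γ.PosDef)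
    (uobs : Fin q → ℝ) (mpr : M)
    (R : M →L[ℝ] M) (hR : ∀ x y : M, ⟪R x, y⟫ = ⟪x, R y⟫)
    (hR₀ : ∀ x : M, 0 ≤ ⟪R x, x⟫)
    (u : M → U) (hu : ∀ m : M, ∀ pt : U, a pt (u m) + c pt m + d pt = 0)
    (J : M → ℝ)
    (hJ : ∀ m : M, J m =
      (1 / 2) * ((Γ⁻¹ *ᵥ (Q (u m) - uobs)) ⬝ᵥ (Q (u m) - uobs))
        + (1 / 2) * ⟪R (m - mpr), m - mpr⟫) :
    Differentiable ℝ J ∧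
    ∃ D : M →L[ℝ] M →L[ℝ] ℝ,
      (∀ m : M, HasFDerivAt (fun m' => fderiv ℝ J m') D m) ∧
      (∀ (mh mt : M) (uh ph : U),
        (∀ pt : U, a pt uh + c pt mh = 0) →
        (∀ ut : U, (Γ⁻¹ *ᵥ (Q uh)) ⬝ᵥ (Q ut) + a ph ut = 0) →
        D mh mt = ⟪R mh, mt⟫ + c ph mt) := by
  obtain ⟨S, hS, huS⟩ := exists_continuousLinearMap_state a c d ha₁ u hu
  obtain ⟨G, hG⟩ := exists_continuousLinearMap_mulVec_dotProduct Γ⁻¹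
  have hGsymm : ∀ x y, G x y = G y x := by
    intro x y
    have hsymm : (Γ⁻¹)ᵀ = Γ⁻¹ := by
      simpa using hΓ.isHermitian.inv.eq
    rw [hG, hG, dotProduct_comm, dotProduct_mulVec, ← mulVec_transpose, hsymm]
  let P : M →L[ℝ] M →L[ℝ] ℝ := (innerSL ℝ).comp R
  have hP : ∀ x y, P x y = ⟪R x, y⟫ := fun _ _ => rfl
  have hPsymm : ∀ x y, P x y = P y x := fun x y => by
    rw [hP, hP, hR, real_inner_comm]
  let T := Q.comp S
  let r := Q (u 0) - uobs
  let id := ContinuousLinearMap.id ℝ M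
  have hJ' : J = fun m => (1 / 2) * G (T m + r) (T m + r)
      + (1 / 2) * P (id m + -mpr) (id m + -mpr) := by
    funext m
    have hr : Q (u m) - uobs = T m + r := by
      simp [T, r, huS m, add_sub_assoc]
    rw [hJ, hr, hG, hP]
    simp [id, sub_eq_add_neg]
  have hderiv : ∀ m, HasFDerivAt J
      ((G (T m + r)).comp T + (P (id m + -mpr)).comp id) m := fun m => by
    rw [hJ']
    exact (hasFDerivAt_half_quadratic_comp_affine G hGsymm T r m).add
      (hasFDerivAt_half_quadratic_comp_affine P hPsymm id (-mpr) m)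
  refine ⟨fun m => (hderiv m).differentiableAt,
    G.bilinearComp T T + P.bilinearComp id id, fun m => ?_, ?_⟩
  · rw [funext fun m => (hderiv m).fderiv]
    exact (hasFDerivAt_bilinear_comp_affine G T r m).add
      (hasFDerivAt_bilinear_comp_affine P id (-mpr) m)
  · intro mh mt uh ph huh hph
    have huS : uh = S mh := by
      refine (ha₁ (-c.flip mh)).unique (fun pt => ?_) (fun pt => ?_)
      · simpa using eq_neg_of_add_eq_zero_left (huh pt)
      · simpa using eq_neg_of_add_eq_zero_left (hS mh pt)
    have h₁ := hph (S mt)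
    have h₂ := hS mt ph
    rw [← hG, huS] at h₁
    change G (Q (S mh)) (Q (S mt)) + ⟪R mh, mt⟫ = _
    linarith
end

section
/- In the abstract linear PDE-constrained setting, fix ψ ∈ M and let (û, p̂) ∈ U × U solve the incremental system: a(p̃, û) + c(p̃, ψ) = 0 for all p̃ ∈ U, and ⟨Γ⁻¹ Q û, Q ũ⟩ + a(p̂, ũ) = 0 for all ũ ∈ U. Set γ := c(p̂, ψ) and s := γ / (2(1 + γ)²) (assuming γ ≠ −1). Suppose (û*, p̂*) ∈ U × U satisfy the Lagrange-multiplier equations: s · c(p̃, ψ) + a(p̃, û*) = 0 for all p̃ ∈ U, and a(p̂*, ũ) + ⟨Γ⁻¹ Q û*, Q ũ⟩ = 0 for all ũ ∈ U. Then û* = s û and p̂* = s p̂; that is, the Lagrange multipliers of the eigenvalue-sensitivity meta-Lagrangian are rescaled versions of the incremental state and adjoint variables, so no additional PDE solves are required to obtain them. -/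
open Matrix

/-- The Lagrange multipliers of the eigenvalue-sensitivity meta-Lagrangian are rescaled
versions of the incremental state and adjoint variables: `û* = s û` and `p̂* = s p̂`
with `s = γ / (2(1 + γ)²)`. -/
theorem stmt_16 {U M : Type*}
    [NormedAddCommGroup U] [InnerProductSpace ℝ U] [CompleteSpace U]
    [NormedAddCommGroup M] [InnerProductSpace ℝ M] [CompleteSpace M]
    {q : ℕ}
    (a : U →L[ℝ] U →L[ℝ] ℝ) (c : U →L[ℝ] M →L[ℝ] ℝ)
    (ha₁ : ∀ ℓ : U →L[ℝ] ℝ, ∃! w : U, ∀ pt : U, a pt w = ℓ pt)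
    (ha₂ : ∀ ℓ : U →L[ℝ] ℝ, ∃! v : U, ∀ ut : U, a v ut = ℓ ut)
    (Q : U →L[ℝ] (Fin q → ℝ)) (Γ : Matrix (Fin q) (Fin q) ℝ) (hΓ : Γ.PosDef)
    (ψ : M) (uh ph : U)
    (hinc1 : ∀ pt : U, a pt uh + c pt ψ = 0)
    (hinc2 : ∀ ut : U, (Γ⁻¹ *ᵥ (Q uh)) ⬝ᵥ (Q ut) + a ph ut = 0)
    (γ s : ℝ) (hγdef : γ = c ph ψ) (hγ : γ ≠ -1)
    (hs : s = γ / (2 * (1 + γ) ^ 2))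
    (uhs phs : U)
    (hmult1 : ∀ pt : U, s * c pt ψ + a pt uhs = 0)
    (hmult2 : ∀ ut : U, a phs ut + (Γ⁻¹ *ᵥ (Q uhs)) ⬝ᵥ (Q ut) = 0) :
    uhs = s • uh ∧ phs = s • ph := by
  have h_state : uhs = s • uh := by
    refine (ha₁ (a.flip uhs)).unique (fun pt => rfl) fun pt => ?_
    simp only [map_smul, smul_eq_mul, ContinuousLinearMap.flip_apply]
    linear_combination s * hinc1 pt - hmult1 pt
  refine ⟨h_state, (ha₂ (a phs)).unique (fun ut => rfl) fun ut => ?_⟩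
  have h_adj := hmult2 ut
  rw [h_state, map_smul, mulVec_smul, smul_dotProduct, smul_eq_mul] at h_adj
  simp only [map_smul, _root_.smul_apply, smul_eq_mul]
  linear_combination s * hinc2 ut - h_adj
end

section
/- In the setting of the post-optimal sensitivity relation, the derivative of the Cameron–Martin-norm term of the information gain satisfies (d/dθ) ⟨m*(θ) − m_pr, C⁻¹(m*(θ) − m_pr)⟩ = −2 ⟨m*(θ) − m_pr, C⁻¹ H(θ)⁻¹ B(θ)⟩, where H(θ) := G(θ)ᵀ Γ⁻¹ G(θ) + C⁻¹, m*(θ) := H(θ)⁻¹ (G(θ)ᵀ Γ⁻¹ (u − f(θ)) + C⁻¹ m_pr), and B(θ) := G′(θ)ᵀ Γ⁻¹ (G(θ) m*(θ) + f(θ) − u) + G(θ)ᵀ Γ⁻¹ (G′(θ) m*(θ) + f′(θ)). -/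
open Matrix

section Calculus

variable {ι κ μ : Type*} {x : ℝ}

theorem HasDerivAt.matrix_mulVec [Fintype κ] {A : ℝ → Matrix ι κ ℝ} {A' : Matrix ι κ ℝ}
    {v : ℝ → κ → ℝ} {v' : κ → ℝ}
    (hA : ∀ i j, HasDerivAt (fun t => A t i j) (A' i j) x) (hv : HasDerivAt v v' x) :
    HasDerivAt (fun t => A t *ᵥ v t) (A' *ᵥ v x + A x *ᵥ v') x := by
  rw [hasDerivAt_pi] at hv ⊢
  intro i
  simp only [Matrix.mulVec, dotProduct, Pi.add_apply, ← Finset.sum_add_distrib]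
  exact HasDerivAt.fun_sum fun j _ => (hA i j).mul (hv j)

theorem HasDerivAt.const_matrix_mulVec [Fintype κ] (A : Matrix ι κ ℝ) {v : ℝ → κ → ℝ} {v' : κ → ℝ}
    (hv : HasDerivAt v v' x) : HasDerivAt (fun t => A *ᵥ v t) (A *ᵥ v') x := by
  simpa using HasDerivAt.matrix_mulVec (A := fun _ => A) (A' := 0)
    (fun i j => hasDerivAt_const x (A i j)) hv

theorem HasDerivAt.dotProduct [Fintype ι] {v w : ℝ → ι → ℝ} {v' w' : ι → ℝ}
    (hv : HasDerivAt v v' x) (hw : HasDerivAt w w' x) :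
    HasDerivAt (fun t => v t ⬝ᵥ w t) (v' ⬝ᵥ w x + v x ⬝ᵥ w') x := by
  rw [hasDerivAt_pi] at hv hw
  simp only [_root_.dotProduct, ← Finset.sum_add_distrib]
  exact HasDerivAt.fun_sum fun j _ => (hv j).mul (hw j)

theorem DifferentiableAt.matrix_mul_apply [Fintype ι] {A : ℝ → Matrix μ ι ℝ}
    {B : ℝ → Matrix ι κ ℝ} (hA : ∀ i j, DifferentiableAt ℝ (fun t => A t i j) x)
    (hB : ∀ i j, DifferentiableAt ℝ (fun t => B t i j) x) (i : μ) (j : κ) :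
    DifferentiableAt ℝ (fun t => (A t * B t) i j) x := by
  simp only [Matrix.mul_apply]
  exact DifferentiableAt.fun_sum fun k _ => (hA i k).mul (hB k j)

variable [Fintype ι] [DecidableEq ι]

theorem DifferentiableAt.matrix_det {A : ℝ → Matrix ι ι ℝ}
    (hA : ∀ i j, DifferentiableAt ℝ (fun t => A t i j) x) :
    DifferentiableAt ℝ (fun t => (A t).det) x := by
  simp only [Matrix.det_apply]
  exact DifferentiableAt.fun_sum fun σ _ =>
    (DifferentiableAt.fun_finsetProd fun i _ => hA (σ i) i).const_smul _

theorem DifferentiableAt.matrix_inv_apply {A : ℝ → Matrix ι ι ℝ}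
    (hA : ∀ i j, DifferentiableAt ℝ (fun t => A t i j) x) (hdet : (A x).det ≠ 0) (i j : ι) :
    DifferentiableAt ℝ (fun t => (A t)⁻¹ i j) x := by
  simp only [Matrix.inv_def, Ring.inverse_eq_inv', Matrix.smul_apply, smul_eq_mul,
    Matrix.adjugate_apply]
  refine ((DifferentiableAt.matrix_det hA).inv hdet).mul (DifferentiableAt.matrix_det ?_)
  intro k l
  by_cases hk : k = j
  · subst hk
    simp
  · simpa [Matrix.updateRow_ne hk] using hA k l

end Calculus

theorem Matrix.PosDef.dotProduct_mulVec_comm {ι : Type*} [Fintype ι] {A : Matrix ι ι ℝ}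
    (hA : A.PosDef) (v w : ι → ℝ) : v ⬝ᵥ (A *ᵥ w) = w ⬝ᵥ (A *ᵥ v) := by
  have h : Aᵀ = A := by simpa using hA.isHermitian.eq
  rw [dotProduct_mulVec, ← mulVec_transpose, h, dotProduct_comm]

theorem Matrix.PosDef.transpose_mul_inv_mul_add_inv {ι κ : Type*} [Fintype ι] [Fintype κ]
    [DecidableEq ι] [DecidableEq κ] {Γ : Matrix ι ι ℝ} {C : Matrix κ κ ℝ} (hΓ : Γ.PosDef)
    (hC : C.PosDef) (G : Matrix ι κ ℝ) : (Gᵀ * Γ⁻¹ * G + C⁻¹).PosDef := by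
  have h := hΓ.inv.posSemidef.conjTranspose_mul_mul_same G
  rw [conjTranspose_eq_transpose_of_trivial] at h
  exact Matrix.PosDef.posSemidef_add h hC.inv

/-- Derivative of the Cameron–Martin-norm term of the information gain:
`(d/dθ) ⟨m*(θ) − m_pr, C⁻¹(m*(θ) − m_pr)⟩ = −2 ⟨m*(θ) − m_pr, C⁻¹ H(θ)⁻¹ B(θ)⟩`. -/
theorem stmt_18 {n q : ℕ} (Θ : Set ℝ) (hΘ : IsOpen Θ)
    (G G' : ℝ → Matrix (Fin q) (Fin n) ℝ) (f f' : ℝ → Fin q → ℝ)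
    (hG : ∀ θ ∈ Θ, ∀ i j, HasDerivAt (fun t => G t i j) (G' θ i j) θ)
    (hf : ∀ θ ∈ Θ, ∀ i, HasDerivAt (fun t => f t i) (f' θ i) θ)
    (Γ : Matrix (Fin q) (Fin q) ℝ) (hΓ : Γ.PosDef)
    (C : Matrix (Fin n) (Fin n) ℝ) (hC : C.PosDef)
    (mpr : Fin n → ℝ) (u : Fin q → ℝ)
    (H : ℝ → Matrix (Fin n) (Fin n) ℝ)
    (hH : ∀ t, H t = (G t)ᵀ * Γ⁻¹ * G t + C⁻¹)
    (mstar : ℝ → Fin n → ℝ)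
    (hmstar : ∀ t, mstar t = (H t)⁻¹ *ᵥ ((G t)ᵀ *ᵥ (Γ⁻¹ *ᵥ (u - f t)) + C⁻¹ *ᵥ mpr))
    (B : ℝ → Fin n → ℝ)
    (hB : ∀ t, B t = (G' t)ᵀ *ᵥ (Γ⁻¹ *ᵥ (G t *ᵥ mstar t + f t - u))
        + (G t)ᵀ *ᵥ (Γ⁻¹ *ᵥ (G' t *ᵥ mstar t + f' t))) :
    ∀ θ ∈ Θ, HasDerivAt
      (fun t => (mstar t - mpr) ⬝ᵥ (C⁻¹ *ᵥ (mstar t - mpr)))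
      (-2 * ((mstar θ - mpr) ⬝ᵥ (C⁻¹ *ᵥ ((H θ)⁻¹ *ᵥ B θ)))) θ := by
  intro θ hθ
  have hpos : ∀ t, (H t).PosDef := fun t => by
    rw [hH]
    exact hΓ.transpose_mul_inv_mul_add_inv hC (G t)
  have hunit : ∀ t, IsUnit (H t).det := fun t => (hpos t).det_pos.ne'.isUnit
  have hGd : ∀ i j, DifferentiableAt ℝ (fun t => G t i j) θ :=
    fun i j => (hG θ hθ i j).differentiableAt
  have hGt : ∀ i j, HasDerivAt (fun t => (G t)ᵀ i j) ((G' θ)ᵀ i j) θ :=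
    fun i j => hG θ hθ j i
  have hfv : HasDerivAt f (f' θ) θ := hasDerivAt_pi.2 (hf θ hθ)
  have hHd : ∀ i j, DifferentiableAt ℝ (fun t => H t i j) θ := by
    intro i j
    simp only [hH, Matrix.add_apply]
    refine (DifferentiableAt.matrix_mul_apply (A := fun t => (G t)ᵀ * Γ⁻¹) ?_ hGd i j).add_const _
    exact DifferentiableAt.matrix_mul_apply (A := fun t => (G t)ᵀ) (B := fun _ => Γ⁻¹)
      (fun i j => (hGt i j).differentiableAt) (fun _ _ => differentiableAt_const _)
  have hrhs : HasDerivAt (fun t => (G t)ᵀ *ᵥ (Γ⁻¹ *ᵥ (u - f t)) + C⁻¹ *ᵥ mpr) _ θ :=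
    (HasDerivAt.matrix_mulVec hGt
      (HasDerivAt.const_matrix_mulVec Γ⁻¹ (hfv.const_sub u))).add_const _
  have hm : HasDerivAt mstar (deriv mstar θ) θ := by
    have h := HasDerivAt.matrix_mulVec (A := fun t => (H t)⁻¹)
      (A' := Matrix.of fun i j => deriv (fun t => (H t)⁻¹ i j) θ) (fun i j =>
        (DifferentiableAt.matrix_inv_apply hHd (hunit θ).ne_zero i j).hasDerivAt) hrhs
    rw [← funext hmstar] at h
    exact h.differentiableAt.hasDerivAt
  have hopt : ∀ t, (G t)ᵀ *ᵥ (Γ⁻¹ *ᵥ (G t *ᵥ mstar t + f t - u)) + C⁻¹ *ᵥ (mstar t - mpr) = 0 := by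
    intro t
    have h : H t *ᵥ mstar t = (G t)ᵀ *ᵥ (Γ⁻¹ *ᵥ (u - f t)) + C⁻¹ *ᵥ mpr := by
      rw [hmstar t, mulVec_mulVec, mul_nonsing_inv _ (hunit t), one_mulVec]
    rw [hH, add_mulVec, ← mulVec_mulVec, ← mulVec_mulVec] at h
    ext i
    replace h := congrFun h i
    simp only [mulVec_add, mulVec_sub, Pi.add_apply, Pi.sub_apply, Pi.zero_apply] at h ⊢
    linarith
  have hderiv := (HasDerivAt.matrix_mulVec hGt (HasDerivAt.const_matrix_mulVec Γ⁻¹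
    (((HasDerivAt.matrix_mulVec (hG θ hθ) hm).fun_add hfv).sub_const u))).fun_add
    (HasDerivAt.const_matrix_mulVec C⁻¹ (hm.sub_const mpr))
  rw [funext hopt] at hderiv
  have hzero := hderiv.unique (hasDerivAt_const θ (0 : Fin n → ℝ))
  have hHm : H θ *ᵥ deriv mstar θ = -B θ := by
    rw [hH, hB, add_mulVec, ← mulVec_mulVec, ← mulVec_mulVec]
    ext i
    replace hzero := congrFun hzero i
    simp only [mulVec_add, mulVec_sub, Pi.add_apply, Pi.sub_apply, Pi.neg_apply,
      Pi.zero_apply] at hzero ⊢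
    linarith
  have hm' : deriv mstar θ = -((H θ)⁻¹ *ᵥ B θ) := by
    rw [← mulVec_neg, ← hHm, mulVec_mulVec, nonsing_inv_mul _ (hunit θ), one_mulVec]
  convert (hm.sub_const mpr).dotProduct
    (HasDerivAt.const_matrix_mulVec C⁻¹ (hm.sub_const mpr)) using 1
  rw [hC.inv.dotProduct_mulVec_comm (deriv mstar θ), hm', mulVec_neg, dotProduct_neg]
  ring
end
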